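/- arXiv:1801.08278 — 7 statements merged into one kernel-verified Lean document; each statement's English description precedes it below -/
import Mathlib

section
/- Soddy's hexlet theorem: Let S₁, S₂, S₃ be three spheres of positive radius in Euclidean 3-space that are pairwise tangent (each pairwise intersection is a singleton), and suppose the three tangency points are pairwise distinct. Then there exist six spheres C₀, C₁, …, C₅ of positive radius such that each Cᵢ is tangent to each of S₁, S₂, S₃; consecutive spheres Cᵢ and C_{i+1 mod 6} are tangent; and any two distinct spheres Cᵢ, Cⱼ are non-intersecting (their intersection contains at most one point). -/
open scoped RealInnerProductSpace

/-- Two spheres (as subsets of a metric space) are *tangent* if their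
intersection is a singleton. -/
def SpheresTangent {α : Type*} (S₁ S₂ : Set α) : Prop := ∃ p, S₁ ∩ S₂ = {p}

/-- Two spheres are *non-intersecting* if their intersection contains at most
one point. -/
def SpheresNonIntersecting {α : Type*} (S₁ S₂ : Set α) : Prop :=
  (S₁ ∩ S₂).Subsingleton

abbrev E3 := EuclideanSpace ℝ (Fin 3)
abbrev LV := E3 × ℝ × ℝ

noncomputable def LB : LV →ₗ[ℝ] LV →ₗ[ℝ] ℝ :=
  LinearMap.mk₂ ℝ (fun v w => ⟪v.1, w.1⟫ - (v.2.1 * w.2.2 + v.2.2 * w.2.1) / 2)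
    (by intro a b c; simp [inner_add_left]; ring)
    (by intro a b c; simp [inner_smul_left]; ring)
    (by intro a b c; simp [inner_add_right]; ring)
    (by intro a b c; simp [inner_smul_right]; ring)

lemma LB_apply (v w : LV) :
    LB v w = ⟪v.1, w.1⟫ - (v.2.1 * w.2.2 + v.2.2 * w.2.1) / 2 := rfl

lemma LB_comm (v w : LV) : LB v w = LB w v := by
  rw [LB_apply, LB_apply, real_inner_comm]; ring

lemma LB_pos {s w : LV} (hs : LB s s < 0) (hsw : LB s w = 0) (hw : w ≠ 0) : 0 < LB w w := by
  obtain ⟨m0, b0, d0⟩ := s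
  obtain ⟨m, b, d⟩ := w
  simp only [LB_apply, real_inner_self_eq_norm_sq] at *
  by_contra hcon
  have hcs : ⟪m0, m⟫ ^ 2 ≤ ‖m0‖ ^ 2 * ‖m‖ ^ 2 := by
    have := abs_real_inner_le_norm m0 m
    rw [← mul_pow, ← sq_abs]
    gcongr
  have h1 : ⟪m0, m⟫ = (b0 * d + d0 * b) / 2 := by linarith
  have hbd : ‖m‖ ^ 2 ≤ b * d := by linarith
  have h0 : ‖m0‖ ^ 2 < b0 * d0 := by linarith
  have hn0 : 0 ≤ ‖m0‖ ^ 2 := by positivity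
  have hn : 0 ≤ ‖m‖ ^ 2 := by positivity
  have hbd0 : 0 < b0 * d0 := by linarith
  rw [h1] at hcs
  have hm : ‖m‖ ^ 2 = 0 := by
    by_contra hne
    have hp : 0 < ‖m‖ ^ 2 := lt_of_le_of_ne hn (Ne.symm hne)
    nlinarith [sq_nonneg (b0 * d - d0 * b), mul_le_mul_of_nonneg_left hbd hbd0.le,
      mul_lt_mul_of_pos_right h0 hp]
  have hm' : m = 0 := by simpa using hm
  subst hm'
  simp at h1 hbd
  have h2 : b0 * d = - (d0 * b) := by linarith
  have h3 : b0 * d0 * b ^ 2 + b0 ^ 2 * (b * d) = 0 := by linear_combination (b0 * b) * h2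
  have hb : b = 0 := by
    have : b0 * d0 * b ^ 2 = 0 := by
      have := mul_nonneg (sq_nonneg b0) hbd
      have := mul_nonneg hbd0.le (sq_nonneg b)
      linarith
    simpa [hbd0.ne'] using this
  subst hb
  have hb0 : b0 ≠ 0 := by rintro rfl; simp at hbd0
  have hd : d = 0 := by simpa [hb0] using h2
  subst hd
  exact hw rfl

noncomputable def ctr (v : LV) : E3 := v.2.1⁻¹ • v.1
noncomputable def rad (v : LV) : ℝ := |v.2.1|⁻¹
def Good (v : LV) : Prop := LB v v = 1 ∧ v.2.1 ≠ 0

lemma good_neg {v : LV} (h : Good v) : Good (-v) := by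
  refine ⟨by simpa using h.1, by simpa using h.2⟩
lemma ctr_neg (v : LV) : ctr (-v) = ctr v := by simp [ctr, inv_neg]
lemma rad_neg (v : LV) : rad (-v) = rad v := by simp [rad]

noncomputable def sv (c : E3) (r : ℝ) : LV := (r⁻¹ • c, r⁻¹, r⁻¹ * (‖c‖ ^ 2 - r ^ 2))
lemma good_sv (c : E3) {r : ℝ} (hr : 0 < r) : Good (sv c r) ∧ ctr (sv c r) = c ∧ rad (sv c r) = r := by
  refine ⟨⟨?_, ?_⟩, ?_, ?_⟩
  · simp only [sv, LB_apply, inner_smul_left, inner_smul_right, real_inner_self_eq_norm_sq]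
    simp
    field_simp
    ring
  · simp [sv, hr.ne']
  · simp [ctr, sv, hr.ne', smul_smul]
  · simp [rad, sv, abs_of_pos hr]

lemma rad_pos {v : LV} (h : Good v) : 0 < rad v := by
  have := h.2
  unfold rad; positivity

lemma good_d {v : LV} (h : Good v) : v.2.2 = v.2.1⁻¹ * (‖v.1‖ ^ 2 - 1) := by
  have h1 := h.1
  have h2 := h.2
  rw [LB_apply, real_inner_self_eq_norm_sq] at h1
  field_simp
  linarith

lemma good_dist {v w : LV} (hv : Good v) (hw : Good w) :
    rad v ^ 2 + rad w ^ 2 - ‖ctr w - ctr v‖ ^ 2 = 2 * v.2.1⁻¹ * w.2.1⁻¹ * LB v w := by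
  rw [LB_apply, good_d hv, good_d hw, norm_sub_sq_real]
  have h1 := hv.2
  have h2 := hw.2
  simp only [ctr, rad, inner_smul_left, inner_smul_right, norm_smul, mul_pow, inv_pow, sq_abs,
    Real.norm_eq_abs, abs_inv]
  rw [real_inner_comm w.1 v.1]
  simp
  field_simp
  ring

lemma good_heron {v w : LV} (hv : Good v) (hw : Good w) :
    (rad v ^ 2 + rad w ^ 2 - ‖ctr w - ctr v‖ ^ 2) ^ 2 = 4 * rad v ^ 2 * rad w ^ 2 * LB v w ^ 2 := by
  rw [good_dist hv hw]
  simp only [rad, inv_pow, sq_abs]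
  ring

lemma good_eq {v w : LV} (hv : Good v) (hw : Good w) (hc : ctr v = ctr w) (hr : rad v = rad w) :
    v = w ∨ v = -w := by
  have hr' : |v.2.1| = |w.2.1| := by simpa [rad] using hr
  have h1 := good_d hv
  have h2 := good_d hw
  have h3 := hw.2
  simp only [ctr] at hc
  rcases abs_eq_abs.1 hr' with h | h
  · left
    rw [h] at hc h1
    have hm : v.1 = w.1 := smul_right_injective _ (inv_ne_zero h3) hc
    rw [hm, ← h2] at h1
    exact Prod.ext hm (Prod.ext h h1)
  · right
    rw [h, inv_neg, neg_smul, ← smul_neg] at hc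
    have hm : -v.1 = w.1 := smul_right_injective _ (inv_ne_zero h3) hc
    have hm' : v.1 = -w.1 := by rw [← hm, neg_neg]
    rw [h, hm', norm_neg, inv_neg, neg_mul, ← h2] at h1
    exact Prod.ext hm' (Prod.ext h h1)

lemma sph_unique {c c' p : E3} {r r' : ℝ} (hne : c' - c ≠ 0)
    (hq : 4 * r ^ 2 * r' ^ 2 ≤ (r ^ 2 + r' ^ 2 - ‖c' - c‖ ^ 2) ^ 2)
    (h1 : ‖p - c‖ = r) (h2 : ‖p - c'‖ = r') :
    p = c + ((r ^ 2 + ‖c' - c‖ ^ 2 - r' ^ 2) / (2 * ‖c' - c‖ ^ 2)) • (c' - c) := by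
  have hD : 0 < ‖c' - c‖ := norm_pos_iff.2 hne
  have e : p - c' = (p - c) - (c' - c) := by abel
  have h3 : r' ^ 2 = r ^ 2 - 2 * ⟪p - c, c' - c⟫ + ‖c' - c‖ ^ 2 := by
    rw [← h2, e, norm_sub_sq_real, h1]
  generalize ht : (r ^ 2 + ‖c' - c‖ ^ 2 - r' ^ 2) / (2 * ‖c' - c‖ ^ 2) = t
  have ht' : r ^ 2 + ‖c' - c‖ ^ 2 - r' ^ 2 = t * (2 * ‖c' - c‖ ^ 2) := by
    rw [← ht]; field_simp
  have h4 : ‖(p - c) - t • (c' - c)‖ ^ 2 = r ^ 2 - t ^ 2 * ‖c' - c‖ ^ 2 := by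
    rw [norm_sub_sq_real, h1, inner_smul_right, norm_smul, mul_pow, Real.norm_eq_abs, sq_abs]
    linear_combination (-t) * ht' - t * h3
  have h5 : r ^ 2 ≤ t ^ 2 * ‖c' - c‖ ^ 2 := by
    have h6 : 4 * ‖c' - c‖ ^ 2 * r ^ 2 ≤ 4 * ‖c' - c‖ ^ 2 * (t ^ 2 * ‖c' - c‖ ^ 2) := by
      have : 4 * ‖c' - c‖ ^ 2 * (t ^ 2 * ‖c' - c‖ ^ 2) = (r ^ 2 + ‖c' - c‖ ^ 2 - r' ^ 2) ^ 2 := by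
        rw [ht']; ring
      rw [this]; nlinarith
    exact le_of_mul_le_mul_left h6 (by positivity)
  have h7 : ‖(p - c) - t • (c' - c)‖ ^ 2 = 0 := le_antisymm (by linarith) (by positivity)
  have h8 : (p - c) - t • (c' - c) = 0 := by simpa using h7
  rw [sub_eq_zero.1 (by rw [← h8]; abel : p - (c + t • (c' - c)) = 0)]

abbrev sph (v : LV) : Set E3 := Metric.sphere (ctr v) (rad v)

lemma good_nonint {v w : LV} (hv : Good v) (hw : Good w) (h1 : v ≠ w) (h2 : v ≠ -w)
    (h : 1 ≤ LB v w ^ 2) : SpheresNonIntersecting (sph v) (sph w) := by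
  intro p hp q hq
  simp only [Set.mem_inter_iff, mem_sphere_iff_norm] at hp hq
  by_cases hne : ctr w - ctr v = 0
  · have hc : ctr w = ctr v := sub_eq_zero.1 hne
    exfalso
    have : rad v = rad w := by rw [← hp.1, ← hp.2, hc]
    rcases good_eq hv hw hc.symm this with h | h
    exacts [h1 h, h2 h]
  · have hq' : 4 * rad v ^ 2 * rad w ^ 2 ≤ (rad v ^ 2 + rad w ^ 2 - ‖ctr w - ctr v‖ ^ 2) ^ 2 := by
      rw [good_heron hv hw]
      exact le_mul_of_one_le_right (by positivity) h
    rw [sph_unique hne hq' hp.1 hp.2, sph_unique hne hq' hq.1 hq.2]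

lemma good_tangent {v w : LV} (hv : Good v) (hw : Good w) (h1 : v ≠ w) (h2 : v ≠ -w)
    (h : LB v w ^ 2 = 1) : SpheresTangent (sph v) (sph w) := by
  have hsub := good_nonint hv hw h1 h2 h.ge
  suffices hex : (sph v ∩ sph w).Nonempty by
    obtain ⟨p, hp⟩ := hex
    exact ⟨p, hsub.eq_singleton_of_mem hp⟩
  have hh := good_heron hv hw
  rw [h, mul_one] at hh
  have hr := rad_pos hv
  have hr' := rad_pos hw
  have hne : ctr w - ctr v ≠ 0 := by
    intro h0
    rw [h0] at hh
    simp only [norm_zero] at hh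
    have : (rad v - rad w) * (rad v + rad w) = 0 := by
      have : ((rad v - rad w) * (rad v + rad w)) ^ 2 = 0 := by linear_combination hh
      simpa using this
    have : rad v = rad w := by
      rcases mul_eq_zero.1 this with h | h <;> linarith
    rcases good_eq hv hw (sub_eq_zero.1 h0).symm this with h | h
    exacts [h1 h, h2 h]
  have hD : 0 < ‖ctr w - ctr v‖ := norm_pos_iff.2 hne
  generalize ht : (rad v ^ 2 + ‖ctr w - ctr v‖ ^ 2 - rad w ^ 2) / (2 * ‖ctr w - ctr v‖ ^ 2) = t
  have ht' : rad v ^ 2 + ‖ctr w - ctr v‖ ^ 2 - rad w ^ 2 = t * (2 * ‖ctr w - ctr v‖ ^ 2) := by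
    rw [← ht]; field_simp
  have h5 : t ^ 2 * ‖ctr w - ctr v‖ ^ 2 = rad v ^ 2 := by
    have h6 : 4 * ‖ctr w - ctr v‖ ^ 2 * (t ^ 2 * ‖ctr w - ctr v‖ ^ 2)
        = 4 * ‖ctr w - ctr v‖ ^ 2 * rad v ^ 2 := by
      have : 4 * ‖ctr w - ctr v‖ ^ 2 * (t ^ 2 * ‖ctr w - ctr v‖ ^ 2)
          = (rad v ^ 2 + ‖ctr w - ctr v‖ ^ 2 - rad w ^ 2) ^ 2 := by rw [ht']; ring
      rw [this]; linear_combination hh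
    exact mul_left_cancel₀ (by positivity) h6
  refine ⟨ctr v + t • (ctr w - ctr v), ?_, ?_⟩
  · rw [mem_sphere_iff_norm, add_sub_cancel_left, ← sq_eq_sq₀ (norm_nonneg _) hr.le, norm_smul,
      mul_pow, Real.norm_eq_abs, sq_abs, h5]
  · have e : ctr v + t • (ctr w - ctr v) - ctr w = (t - 1) • (ctr w - ctr v) := by
      rw [sub_smul, one_smul]; abel
    rw [mem_sphere_iff_norm, e, ← sq_eq_sq₀ (norm_nonneg _) hr'.le, norm_smul,
      mul_pow, Real.norm_eq_abs, sq_abs]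
    linear_combination h5 + ht'

lemma tangent_collinear {c c' p : E3} {r r' : ℝ}
    (h : Metric.sphere c r ∩ Metric.sphere c' r' = {p}) :
    ∃ t : ℝ, p - c = t • (c' - c) := by
  have hp : p ∈ Metric.sphere c r ∩ Metric.sphere c' r' := by rw [h]; rfl
  simp only [Set.mem_inter_iff, mem_sphere_iff_norm] at hp
  set t : ℝ := ⟪p - c, c' - c⟫ / ‖c' - c‖ ^ 2 with ht
  have ht' : t * ‖c' - c‖ ^ 2 = ⟪p - c, c' - c⟫ := by
    by_cases h0 : c' - c = 0
    · simp [h0]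
    · have : ‖c' - c‖ ≠ 0 := norm_ne_zero_iff.2 h0
      rw [ht]; field_simp
  have hz : c + ((2 * t) • (c' - c) - (p - c)) ∈ Metric.sphere c r ∩ Metric.sphere c' r' := by
    have hr := (norm_nonneg (p - c))
    have hr' := (norm_nonneg (p - c'))
    constructor
    · rw [mem_sphere_iff_norm, add_sub_cancel_left, ← hp.1, ← sq_eq_sq₀ (norm_nonneg _) hr,
        norm_sub_sq_real, inner_smul_left, real_inner_comm, norm_smul, mul_pow, Real.norm_eq_abs,
        sq_abs, ← ht']
      simp
      ring
    · have e : c + ((2 * t) • (c' - c) - (p - c)) - c' = (2 * t - 1) • (c' - c) - (p - c) := by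
        rw [sub_smul, one_smul]; abel
      have e' : p - c' = (p - c) - (c' - c) := by abel
      rw [mem_sphere_iff_norm, ← hp.2, ← sq_eq_sq₀ (norm_nonneg _) hr', e, e',
        norm_sub_sq_real, norm_sub_sq_real (p - c), inner_smul_left, real_inner_comm, norm_smul,
        mul_pow, Real.norm_eq_abs,
        sq_abs, ← ht']
      simp
      ring
  rw [h, Set.mem_singleton_iff] at hz
  refine ⟨t, ?_⟩
  have h1 : (2 : ℝ) • (p - c) = (2 : ℝ) • (t • (c' - c)) := by
    rw [smul_smul, two_smul]
    nth_rw 1 [← hz]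
    abel
  exact smul_right_injective _ two_ne_zero h1

lemma tangent_LB {v w : LV} {p : E3} (hv : Good v) (hw : Good w)
    (h : sph v ∩ sph w = {p}) : LB v w ^ 2 = 1 ∧ v ≠ w ∧ v ≠ -w := by
  have hp : p ∈ sph v ∩ sph w := by rw [h]; rfl
  obtain ⟨t, ht⟩ := tangent_collinear h
  simp only [Set.mem_inter_iff, mem_sphere_iff_norm] at hp
  have hr := rad_pos hv
  have hr' := rad_pos hw
  have hne : ctr v ≠ ctr w := by
    intro h0
    rw [h0, sub_self, smul_zero] at ht
    rw [h0, ht, norm_zero] at hp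
    linarith [hp.1]
  refine ⟨?_, ?_, ?_⟩
  · have hh := good_heron hv hw
    have e : p - ctr w = (t - 1) • (ctr w - ctr v) := by
      rw [sub_smul, one_smul, ← ht]; abel
    have h1 : rad v ^ 2 = t ^ 2 * ‖ctr w - ctr v‖ ^ 2 := by
      rw [← hp.1, ht, norm_smul, mul_pow, Real.norm_eq_abs, sq_abs]
    have h2 : rad w ^ 2 = (t - 1) ^ 2 * ‖ctr w - ctr v‖ ^ 2 := by
      rw [← hp.2, e, norm_smul, mul_pow, Real.norm_eq_abs, sq_abs]
    have h3 : (rad v ^ 2 + rad w ^ 2 - ‖ctr w - ctr v‖ ^ 2) ^ 2 = 4 * rad v ^ 2 * rad w ^ 2 := by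
      rw [h1, h2]; ring
    rw [h3] at hh
    have h4 : 4 * rad v ^ 2 * rad w ^ 2 ≠ 0 := by positivity
    exact mul_left_cancel₀ h4 (by rw [← hh, mul_one])
  · rintro rfl; exact hne rfl
  · rintro rfl; exact hne (ctr_neg w)

/-- point vector -/
noncomputable def pv (p : E3) : LV := (p, 1, ‖p‖ ^ 2)

lemma pv_mem {v : LV} {p : E3} (hv : Good v) (hp : p ∈ sph v) : LB v (pv p) = 0 := by
  rw [mem_sphere_iff_norm] at hp
  have h2 := hv.2
  have h : ‖p - ctr v‖ ^ 2 = rad v ^ 2 := by rw [hp]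
  rw [norm_sub_sq_real] at h
  rw [LB_apply, good_d hv]
  simp only [ctr, rad, inner_smul_right, norm_smul, mul_pow, inv_pow, sq_abs,
    Real.norm_eq_abs, abs_inv] at h
  simp only [pv]
  rw [real_inner_comm]
  field_simp at h ⊢
  linarith

lemma null_pv {n : LV} {p : E3} (h : LB n n = 0) (hp : LB n (pv p) = 0) : n = n.2.1 • pv p := by
  obtain ⟨m, b, d⟩ := n
  simp only [LB_apply, pv, real_inner_self_eq_norm_sq] at h hp
  have hm : ‖m - b • p‖ ^ 2 = 0 := by
    rw [norm_sub_sq_real, inner_smul_right, norm_smul, mul_pow, Real.norm_eq_abs, sq_abs]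
    linear_combination h - 2 * b * hp
  have hm' : m = b • p := by
    have : m - b • p = 0 := by simpa using hm
    exact sub_eq_zero.1 this
  have hd : d = b * ‖p‖ ^ 2 := by
    rw [hm', inner_smul_left, real_inner_self_eq_norm_sq] at hp
    simp at hp
    linarith
  simp [pv, hm', hd]

lemma bad_case {v₁ v₂ v₃ : LV} (g₁ : Good v₁) (g₂ : Good v₂) (g₃ : Good v₃) {p q : E3}
    (hp1 : p ∈ sph v₁) (hp2 : p ∈ sph v₂) (hq1 : q ∈ sph v₁) (hq3 : q ∈ sph v₃)
    (h12 : LB v₁ v₂ = -1) (h13 : LB v₁ v₃ = -1) (h23 : LB v₂ v₃ = 1)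
    (n12 : v₁ ≠ -v₂) (n13 : v₁ ≠ -v₃) : p = q := by
  have e1 : v₁ + v₂ = (v₁ + v₂).2.1 • pv p := by
    apply null_pv
    · simp [LB_comm v₂ v₁, g₁.1, g₂.1, h12]
    · simp [pv_mem g₁ hp1, pv_mem g₂ hp2]
  have e2 : v₁ + v₃ = (v₁ + v₃).2.1 • pv q := by
    apply null_pv
    · simp [LB_comm v₃ v₁, g₁.1, g₃.1, h13]
    · simp [pv_mem g₁ hq1, pv_mem g₃ hq3]
  have h0 : LB (v₁ + v₂) (v₁ + v₃) = 0 := by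
    simp [LB_comm v₂ v₁, g₁.1, h12, h13, h23]
  have hb1 : (v₁ + v₂).2.1 ≠ 0 := by
    intro h; rw [h, zero_smul] at e1; exact n12 (eq_neg_of_add_eq_zero_left e1)
  have hb2 : (v₁ + v₃).2.1 ≠ 0 := by
    intro h; rw [h, zero_smul] at e2; exact n13 (eq_neg_of_add_eq_zero_left e2)
  rw [e1, e2, map_smul, map_smul, LinearMap.smul_apply, smul_eq_mul, smul_eq_mul] at h0
  have h3 : LB (pv p) (pv q) = 0 := by
    exact (mul_eq_zero.1 ((mul_eq_zero.1 h0).resolve_left hb2)).resolve_left hb1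
  have h4 : ‖p - q‖ ^ 2 = 0 := by
    rw [norm_sub_sq_real]
    simp only [LB_apply, pv] at h3
    linarith
  exact sub_eq_zero.1 (by simpa using h4)

lemma exists_orth (f : Fin 4 → (LV →ₗ[ℝ] ℝ)) : ∃ x : LV, x ≠ 0 ∧ ∀ i, f i x = 0 := by
  have h : (LinearMap.pi f).ker ≠ ⊥ := by
    apply LinearMap.ker_ne_bot_of_finrank_lt
    simp
  obtain ⟨x, hx, hx0⟩ := Submodule.exists_mem_ne_zero_of_ne_bot h
  refine ⟨x, hx0, fun i => ?_⟩
  exact congrFun (LinearMap.mem_ker.1 hx) i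

lemma hexagon {a y : ℝ} (ha : a ≠ 0) : ∃ α β : Fin 6 → ℝ,
    (∀ i, α i * α i + β i * β i = 4) ∧
    (∀ i, α i * α (i + 1) + β i * β (i + 1) = 2) ∧
    (∀ i j, i ≠ j → α i * α j + β i * β j ≤ 2) ∧ ∀ i, a + β i * y ≠ 0 := by
  have h3 : √3 * √3 = 3 := Real.mul_self_sqrt (by norm_num)
  by_cases h : a ^ 2 = 3 * y ^ 2
  · refine ⟨![0, √3, √3, 0, -√3, -√3], ![2, 1, -1, -2, -1, 1], ?_, ?_, ?_, ?_⟩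
    · intro i; fin_cases i <;> simp <;> linarith
    · intro i; fin_cases i <;> simp <;> linarith
    · intro i j hij; fin_cases i <;> fin_cases j <;> simp at hij ⊢ <;> linarith
    · have hy : 0 < y ^ 2 := by
        have : 0 < a ^ 2 := by positivity
        linarith
      have k : ∀ b : ℝ, b ^ 2 = 1 ∨ b ^ 2 = 4 → a + b * y ≠ 0 := by
        intro b hb h'
        have h2 : a ^ 2 = b ^ 2 * y ^ 2 := by linear_combination (a - b * y) * h'
        rcases hb with hb | hb <;> rw [hb] at h2 <;> linarith
      intro i
      apply k
      fin_cases i <;> norm_num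
  · refine ⟨![2, 1, -1, -2, -1, 1], ![0, √3, √3, 0, -√3, -√3], ?_, ?_, ?_, ?_⟩
    · intro i; fin_cases i <;> simp <;> linarith
    · intro i; fin_cases i <;> simp <;> linarith
    · intro i j hij; fin_cases i <;> fin_cases j <;> simp at hij ⊢ <;> linarith
    · have k1 : a + √3 * y ≠ 0 := fun h' => h (by linear_combination (a - √3 * y) * h' + y ^ 2 * h3)
      have k2 : a - √3 * y ≠ 0 := fun h' => h (by linear_combination (a + √3 * y) * h' + y ^ 2 * h3)
      intro i; fin_cases i <;> simp [ha, k1, k2, ← sub_eq_add_neg]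

lemma lv_normalize {x : LV} (h : 0 < LB x x) : ∃ k : ℝ, LB (k • x) (k • x) = 1 := by
  refine ⟨(√(LB x x))⁻¹, ?_⟩
  have h2 : √(LB x x) ^ 2 = LB x x := Real.sq_sqrt h.le
  have : √(LB x x) ≠ 0 := (Real.sqrt_pos.2 h).ne'
  rw [map_smul, map_smul, LinearMap.smul_apply, smul_eq_mul, smul_eq_mul]
  field_simp
  exact h2.symm

lemma good_main {v₁ v₂ v₃ : LV} (g₁ : Good v₁) (g₂ : Good v₂) (g₃ : Good v₃)
    (h12 : LB v₁ v₂ = -1) (h13 : LB v₁ v₃ = -1) (h23 : LB v₂ v₃ = -1) :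
    ∃ w : Fin 6 → LV, (∀ i, Good (w i)) ∧
      (∀ i, SpheresTangent (sph (w i)) (sph v₁) ∧ SpheresTangent (sph (w i)) (sph v₂) ∧
        SpheresTangent (sph (w i)) (sph v₃)) ∧
      (∀ i, SpheresTangent (sph (w i)) (sph (w (i + 1)))) ∧
      (∀ i j, i ≠ j → SpheresNonIntersecting (sph (w i)) (sph (w j))) := by
  have h21 := (LB_comm v₂ v₁).trans h12
  have h31 := (LB_comm v₃ v₁).trans h13
  have h32 := (LB_comm v₃ v₂).trans h23
  set s := v₁ + v₂ + v₃ with hs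
  have s1 : LB s v₁ = -1 := by simp [hs, g₁.1, h21, h31]
  have s2 : LB s v₂ = -1 := by simp [hs, g₂.1, h12, h32]
  have s3 : LB s v₃ = -1 := by simp [hs, g₃.1, h13, h23]
  have ss : LB s s = -3 := by
    nth_rw 2 [hs]
    rw [map_add, map_add, s1, s2, s3]; norm_num
  have sb : s.2.1 ≠ 0 := by
    intro h0
    rw [LB_apply, h0, real_inner_self_eq_norm_sq] at ss
    have := sq_nonneg ‖s.1‖
    linarith
  obtain ⟨x', hx0, hx⟩ := exists_orth ![LB v₁, LB v₂, LB v₃,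
    (LinearMap.fst ℝ ℝ ℝ).comp (LinearMap.snd ℝ E3 (ℝ × ℝ))]
  have x1' : LB v₁ x' = 0 := hx 0
  have x2' : LB v₂ x' = 0 := hx 1
  have x3' : LB v₃ x' = 0 := hx 2
  have xb' : x'.2.1 = 0 := hx 3
  obtain ⟨k, hk⟩ := lv_normalize (LB_pos (s := s) (by linarith) (by simp [hs, x1', x2', x3']) hx0)
  generalize hxk : k • x' = x at hk
  have x1 : LB v₁ x = 0 := by simp [← hxk, x1']
  have x2 : LB v₂ x = 0 := by simp [← hxk, x2']
  have x3 : LB v₃ x = 0 := by simp [← hxk, x3']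
  have xb : x.2.1 = 0 := by simp [← hxk, xb']
  obtain ⟨y', hy0, hy⟩ := exists_orth ![LB v₁, LB v₂, LB v₃, LB x]
  have y1' : LB v₁ y' = 0 := hy 0
  have y2' : LB v₂ y' = 0 := hy 1
  have y3' : LB v₃ y' = 0 := hy 2
  have xy' : LB x y' = 0 := hy 3
  obtain ⟨l, hl⟩ := lv_normalize (LB_pos (s := s) (by linarith) (by simp [hs, y1', y2', y3']) hy0)
  generalize hyl : l • y' = y at hl
  have y1 : LB v₁ y = 0 := by simp [← hyl, y1']
  have y2 : LB v₂ y = 0 := by simp [← hyl, y2']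
  have y3 : LB v₃ y = 0 := by simp [← hyl, y3']
  have xy : LB x y = 0 := by simp [← hyl, xy']
  have yx := (LB_comm y x).trans xy
  have sx : LB s x = 0 := by simp [hs, x1, x2, x3]
  have sy : LB s y = 0 := by simp [hs, y1, y2, y3]
  have xs := (LB_comm x s).trans sx
  have ys := (LB_comm y s).trans sy
  have x1c := (LB_comm x v₁).trans x1
  have x2c := (LB_comm x v₂).trans x2
  have x3c := (LB_comm x v₃).trans x3
  have y1c := (LB_comm y v₁).trans y1
  have y2c := (LB_comm y v₂).trans y2
  have y3c := (LB_comm y v₃).trans y3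
  obtain ⟨α, β, hab, hadj, hne, hnz⟩ := hexagon (y := y.2.1) sb
  clear_value s
  let w : Fin 6 → LV := fun i => s + α i • x + β i • y
  have ww : ∀ i j, LB (w i) (w j) = -3 + (α i * α j + β i * β j) := by
    intro i j
    simp [w, ss, sx, sy, xs, ys, xy, yx, hk, hl]
    ring
  have w1 : ∀ i, LB (w i) v₁ = -1 := by intro i; simp [w, s1, x1c, y1c]
  have w2 : ∀ i, LB (w i) v₂ = -1 := by intro i; simp [w, s2, x2c, y2c]
  have w3 : ∀ i, LB (w i) v₃ = -1 := by intro i; simp [w, s3, x3c, y3c]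
  have gw : ∀ i, Good (w i) := by
    intro i
    refine ⟨by rw [ww, hab]; norm_num, ?_⟩
    have := hnz i
    simpa [w, xb] using this
  clear_value w
  have T : ∀ i (a b : LV), Good a → LB (w i) a = -1 → LB (w i) b = -1 → LB a b = -1 →
      SpheresTangent (sph (w i)) (sph a) := by
    intro i a b ga ha hb hab
    refine good_tangent (gw i) ga ?_ ?_ (by rw [ha]; norm_num)
    · intro h; rw [h, ga.1] at ha; norm_num at ha
    · intro h; rw [h, map_neg, LinearMap.neg_apply, hab] at hb; norm_num at hb
  have N : ∀ i j, i ≠ j → w i ≠ w j ∧ w i ≠ - w j := by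
    intro i j hij
    constructor
    · intro h
      have h1 := ww i j
      have h2 := hne i j hij
      rw [h, (gw j).1] at h1
      linarith
    · intro h
      have h1 := w1 i
      rw [h, map_neg, LinearMap.neg_apply, w1 j] at h1
      norm_num at h1
  refine ⟨w, gw, fun i => ⟨T i _ v₂ g₁ (w1 i) (w2 i) h12, T i _ v₁ g₂ (w2 i) (w1 i) h21,
    T i _ v₁ g₃ (w3 i) (w1 i) h31⟩, ?_, ?_⟩
  · intro i
    have hi : i ≠ i + 1 := by fin_cases i <;> decide
    refine good_tangent (gw _) (gw _) (N _ _ hi).1 (N _ _ hi).2 ?_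
    rw [ww, hadj]; norm_num
  · intro i j hij
    refine good_nonint (gw _) (gw _) (N _ _ hij).1 (N _ _ hij).2 ?_
    rw [ww]
    have := hne i j hij
    nlinarith

lemma choose_sign {v w : LV} (hw : Good w) (h : LB v w ^ 2 = 1) :
    ∃ w', Good w' ∧ ctr w' = ctr w ∧ rad w' = rad w ∧ LB v w' = -1 := by
  rcases (sq_eq_sq_iff_eq_or_eq_neg.1 (h.trans (one_pow 2).symm)) with h | h
  · exact ⟨-w, good_neg hw, ctr_neg w, rad_neg w, by simp [h]⟩
  · exact ⟨w, hw, rfl, rfl, h⟩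

/-- **Soddy's hexlet.** Given three pairwise tangent spheres of positive radius
in Euclidean 3-space with pairwise distinct tangency points, there is a chain of
six spheres, each tangent to all three given spheres, consecutive spheres in the
chain (cyclically) tangent, and any two distinct spheres of the chain
non-intersecting. -/
theorem soddy_hexlet
    (c₁ c₂ c₃ : EuclideanSpace ℝ (Fin 3)) (r₁ r₂ r₃ : ℝ)
    (hr₁ : 0 < r₁) (hr₂ : 0 < r₂) (hr₃ : 0 < r₃)
    (p₁₂ p₁₃ p₂₃ : EuclideanSpace ℝ (Fin 3))
    (h₁₂ : Metric.sphere c₁ r₁ ∩ Metric.sphere c₂ r₂ = {p₁₂})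
    (h₁₃ : Metric.sphere c₁ r₁ ∩ Metric.sphere c₃ r₃ = {p₁₃})
    (h₂₃ : Metric.sphere c₂ r₂ ∩ Metric.sphere c₃ r₃ = {p₂₃})
    (hpts : p₁₂ ≠ p₁₃ ∧ p₁₂ ≠ p₂₃ ∧ p₁₃ ≠ p₂₃) :
    ∃ (c : Fin 6 → EuclideanSpace ℝ (Fin 3)) (ρ : Fin 6 → ℝ),
      (∀ i, 0 < ρ i) ∧
      (∀ i, SpheresTangent (Metric.sphere (c i) (ρ i)) (Metric.sphere c₁ r₁) ∧
            SpheresTangent (Metric.sphere (c i) (ρ i)) (Metric.sphere c₂ r₂) ∧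
            SpheresTangent (Metric.sphere (c i) (ρ i)) (Metric.sphere c₃ r₃)) ∧
      (∀ i : Fin 6,
        SpheresTangent (Metric.sphere (c i) (ρ i))
          (Metric.sphere (c (i + 1)) (ρ (i + 1)))) ∧
      (∀ i j : Fin 6, i ≠ j →
        SpheresNonIntersecting (Metric.sphere (c i) (ρ i))
          (Metric.sphere (c j) (ρ j))) := by
  obtain ⟨g₁, e₁, f₁⟩ := good_sv c₁ hr₁
  obtain ⟨g₂, e₂, f₂⟩ := good_sv c₂ hr₂
  obtain ⟨g₃, e₃, f₃⟩ := good_sv c₃ hr₃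
  generalize sv c₁ r₁ = v₁ at g₁ e₁ f₁
  generalize sv c₂ r₂ = v₂ at g₂ e₂ f₂
  generalize sv c₃ r₃ = v₃ at g₃ e₃ f₃
  subst e₁ f₁ e₂ f₂ e₃ f₃
  obtain ⟨v₂', g₂', e₂, f₂, h12⟩ := choose_sign g₂ (tangent_LB g₁ g₂ h₁₂).1
  obtain ⟨v₃', g₃', e₃, f₃, h13⟩ := choose_sign g₃ (tangent_LB g₁ g₃ h₁₃).1
  rw [← e₂, ← f₂] at h₁₂ h₂₃ ⊢
  rw [← e₃, ← f₃] at h₁₃ h₂₃ ⊢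
  have t12 := tangent_LB g₁ g₂' h₁₂
  have t13 := tangent_LB g₁ g₃' h₁₃
  have t23 := tangent_LB g₂' g₃' h₂₃
  have m12 : p₁₂ ∈ sph v₁ ∩ sph v₂' := by rw [h₁₂]; rfl
  have m13 : p₁₃ ∈ sph v₁ ∩ sph v₃' := by rw [h₁₃]; rfl
  have h23 : LB v₂' v₃' = -1 := by
    rcases (sq_eq_sq_iff_eq_or_eq_neg.1 (t23.1.trans (one_pow 2).symm)) with h | h
    · exact absurd (bad_case g₁ g₂' g₃' m12.1 m12.2 m13.1 m13.2 h12 h13 h t12.2.2 t13.2.2) hpts.1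
    · exact h
  obtain ⟨w, gw, hT, hA, hN⟩ := good_main g₁ g₂' g₃' h12 h13 h23
  exact ⟨fun i => ctr (w i), fun i => rad (w i), fun i => rad_pos (gw i), hT, hA, hN⟩
end

section
/- Let n ≥ 2 and let S₁, S₂ be two spheres of positive radius in Euclidean n-space that are tangent (their intersection is a singleton). Let Y be a finite set of points in ℝ^{n−1} with pairwise distances at least 2. Then there exists an injective assignment y ↦ C_y of spheres of positive radius to the points of Y such that each C_y is tangent to both S₁ and S₂; for distinct y, z ∈ Y the spheres C_y and C_z are non-intersecting (intersection contains at most one point); and C_y and C_z are tangent if and only if dist(y, z) = 2. -/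
open scoped RealInnerProductSpace

section Helpers
variable {E : Type*} [NormedAddCommGroup E] [InnerProductSpace ℝ E]

lemma aux_tangent (u w : E) (r τ : ℝ) (hr : 0 < r) (h : dist u w ^ 2 = (r + τ) ^ 2)
    (hne : u ≠ w) : SpheresTangent (Metric.sphere u r) (Metric.sphere w |τ|) := by
  have hd : 0 < dist u w := dist_pos.mpr hne
  have h0 : r + τ ≠ 0 := by
    intro h0
    rw [h0] at h
    nlinarith
  obtain ⟨v, rfl⟩ : ∃ v, w = u + v := ⟨w - u, by abel⟩
  have hv : ‖v‖ ^ 2 = (r + τ) ^ 2 := by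
    rw [← h, dist_self_add_right]
  have hv' : ‖v‖ = |r + τ| := by
    rw [← abs_norm v]; exact (sq_eq_sq_iff_abs_eq_abs _ _).mp hv
  refine ⟨u + (r / (r + τ)) • v, ?_⟩
  ext x
  simp only [Set.mem_inter_iff, mem_sphere_iff_norm, Set.mem_singleton_iff]
  constructor
  · rintro ⟨h1, h2⟩
    obtain ⟨ξ, rfl⟩ : ∃ ξ, x = u + ξ := ⟨x - u, by abel⟩
    rw [add_sub_cancel_left] at h1
    rw [add_sub_add_left_eq_sub] at h2
    have h3 := norm_sub_sq_real ξ v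
    rw [h2, h1, hv, sq_abs] at h3
    have h4 : ⟪ξ, v⟫ = r * (r + τ) := by linarith
    have h5 := norm_sub_sq_real ξ ((r / (r + τ)) • v)
    rw [inner_smul_right, norm_smul, mul_pow, hv, h1, h4, Real.norm_eq_abs, sq_abs] at h5
    have h6 : ‖ξ - (r / (r + τ)) • v‖ ^ 2 = 0 := by
      rw [h5]; field_simp; ring
    have h7 := sub_eq_zero.mp (norm_eq_zero.mp (pow_eq_zero_iff (two_ne_zero) |>.mp h6))
    rw [← h7]
  · rintro rfl
    have hp : 0 < |r + τ| := abs_pos.mpr h0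
    constructor
    · rw [add_sub_cancel_left, norm_smul, hv', Real.norm_eq_abs, abs_div, abs_of_pos hr]
      field_simp
    · have : u + (r / (r + τ)) • v - (u + v) = (-τ / (r + τ)) • v := by
        have : (-τ / (r + τ)) = r / (r + τ) - 1 := by field_simp; ring
        rw [this, sub_smul, one_smul]; abel
      rw [this, norm_smul, hv', Real.norm_eq_abs, abs_div, abs_neg]
      field_simp

lemma aux_disjoint (u w : E) (r s : ℝ) (h : r + s < dist u w) :
    Metric.sphere u r ∩ Metric.sphere w s = ∅ := by
  ext x
  simp only [Set.mem_inter_iff, Metric.mem_sphere, Set.mem_empty_iff_false, iff_false, not_and]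
  intro h1 h2
  have := dist_triangle_left u w x
  linarith

lemma aux_ne (u w : E) (r s : ℝ) (hr : 0 < r) (hx : (Metric.sphere u r).Nonempty)
    (h : SpheresNonIntersecting (Metric.sphere u r) (Metric.sphere w s)) :
    Metric.sphere u r ≠ Metric.sphere w s := by
  intro he
  unfold SpheresNonIntersecting at h
  rw [← he, Set.inter_self] at h
  obtain ⟨x, hx⟩ := hx
  have hx2 : u + (u - x) ∈ Metric.sphere u r := by
    rw [mem_sphere_iff_norm] at *
    rw [add_sub_cancel_left, norm_sub_rev]; exact hx
  have h1 := h hx hx2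
  rw [mem_sphere_iff_norm] at hx
  have h2 : (2:ℝ) • (x - u) = 0 := by
    rw [two_smul]; nth_rewrite 1 [h1]; abel
  have h3 : x - u = 0 := by simpa using h2
  rw [h3, norm_zero] at hx
  linarith

lemma aux_line [FiniteDimensional ℝ E] (c₁ c₂ : E) (r₁ r₂ : ℝ) (hr₁ : 0 < r₁) (hr₂ : 0 < r₂)
    (htan : SpheresTangent (Metric.sphere c₁ r₁) (Metric.sphere c₂ r₂)) :
    ∃ (p e : E) (a b : ℝ), ‖e‖ = 1 ∧ c₁ = p + a • e ∧ c₂ = p + b • e ∧ |a| = r₁ ∧ |b| = r₂ ∧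
      a ≠ b := by
  obtain ⟨p, hp⟩ := htan
  have hp1 : p ∈ Metric.sphere c₁ r₁ ∩ Metric.sphere c₂ r₂ := by rw [hp]; rfl
  obtain ⟨h1, h2⟩ := hp1
  have hq : EuclideanGeometry.reflection (line[ℝ, c₁, c₂]) p ∈
      Metric.sphere c₁ r₁ ∩ Metric.sphere c₂ r₂ := by
    constructor
    · rw [Metric.mem_sphere, dist_comm,
        EuclideanGeometry.dist_reflection_eq_of_mem _ (left_mem_affineSpan_pair ℝ c₁ c₂), dist_comm]
      exact h1
    · rw [Metric.mem_sphere, dist_comm,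
        EuclideanGeometry.dist_reflection_eq_of_mem _ (right_mem_affineSpan_pair ℝ c₁ c₂), dist_comm]
      exact h2
  rw [hp, Set.mem_singleton_iff, EuclideanGeometry.reflection_eq_self_iff] at hq
  obtain ⟨k, rfl⟩ := (mem_affineSpan_pair_iff_exists_lineMap_eq).mp hq
  rw [AffineMap.lineMap_apply, vsub_eq_sub, vadd_eq_add] at h1 h2
  rw [mem_sphere_iff_norm] at h1 h2
  have hne : c₂ - c₁ ≠ 0 := by
    intro h0
    rw [h0] at h1
    simp at h1
    linarith
  have hd : ‖c₂ - c₁‖ ≠ 0 := norm_ne_zero_iff.mpr hne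
  refine ⟨k • (c₂ - c₁) + c₁, ‖c₂ - c₁‖⁻¹ • (c₂ - c₁), -k * ‖c₂ - c₁‖, (1 - k) * ‖c₂ - c₁‖,
    ?_, ?_, ?_, ?_, ?_, ?_⟩
  · rw [norm_smul, norm_inv, norm_norm]; field_simp
  · rw [smul_smul, mul_assoc, mul_inv_cancel₀ hd]; module
  · rw [smul_smul, mul_assoc, mul_inv_cancel₀ hd]; module
  · rw [← h1, add_sub_cancel_right, norm_smul, abs_mul, abs_neg, abs_norm, Real.norm_eq_abs]
  · have : k • (c₂ - c₁) + c₁ - c₂ = -((1 - k) • (c₂ - c₁)) := by module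
    rw [← h2, this, norm_neg, norm_smul, abs_mul, abs_norm, Real.norm_eq_abs]
  · intro h
    apply hd
    linarith

/-- tangency to a base sphere -/
lemma aux_base (p e g : E) (he : ‖e‖ = 1) (hg : ⟪g, e⟫ = 0) (hg1 : 1 < ‖g‖)
    (a m h D : ℝ) (hh : 0 < h)
    (ha : 1 - 2 * a * m = 2 * a * h ∨ 1 - 2 * a * m = - (2 * a * h))
    (hD : D = m ^ 2 + h ^ 2 * (‖g‖ ^ 2 - 1)) (hD0 : 0 < D) :
    SpheresTangent (Metric.sphere (p + D⁻¹ • (m • e + h • g)) (h / D))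
      (Metric.sphere (p + a • e) |a|) := by
  have hdist : dist (p + D⁻¹ • (m • e + h • g)) (p + a • e) ^ 2 =
      (m / D - a) ^ 2 + (h / D) ^ 2 * ‖g‖ ^ 2 := by
    rw [dist_add_left, dist_eq_norm]
    have : D⁻¹ • (m • e + h • g) - a • e = (m / D - a) • e + (h / D) • g := by
      rw [div_eq_inv_mul, div_eq_inv_mul]; module
    rw [this, norm_add_sq_real, norm_smul, norm_smul, inner_smul_left, inner_smul_right,
      real_inner_comm, hg, he, mul_pow, mul_pow, Real.norm_eq_abs, Real.norm_eq_abs, sq_abs, sq_abs]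
    ring
  have hval : (m / D - a) ^ 2 + (h / D) ^ 2 * ‖g‖ ^ 2 =
      (h / D) ^ 2 + a ^ 2 + (1 - 2 * a * m) / D := by
    have : h ^ 2 * ‖g‖ ^ 2 = D - m ^ 2 + h ^ 2 := by rw [hD]; ring
    rw [div_pow h, div_mul_eq_mul_div, this]
    field_simp
    ring
  have hne : p + D⁻¹ • (m • e + h • g) ≠ p + a • e := by
    intro h0
    rw [h0, dist_self] at hdist
    have : 0 < (h / D) ^ 2 * ‖g‖ ^ 2 := by positivity
    nlinarith [sq_nonneg (m / D - a)]
  rcases ha with ha | ha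
  · apply aux_tangent _ _ _ _ (by positivity) _ hne
    rw [hdist, hval, ha]; ring
  · rw [← abs_neg a]
    apply aux_tangent _ _ _ _ (by positivity) _ hne
    rw [hdist, hval, ha]; ring

lemma aux_pair (p e g g' : E) (he : ‖e‖ = 1) (hg : ⟪g, e⟫ = 0) (hg' : ⟪g', e⟫ = 0)
    (m h D D' : ℝ)
    (hD : D = m ^ 2 + h ^ 2 * (‖g‖ ^ 2 - 1)) (hD0 : 0 < D)
    (hD' : D' = m ^ 2 + h ^ 2 * (‖g'‖ ^ 2 - 1)) (hD0' : 0 < D') :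
    dist (p + D⁻¹ • (m • e + h • g)) (p + D'⁻¹ • (m • e + h • g')) ^ 2 =
      (h / D + h / D') ^ 2 + h ^ 2 * (dist g g' ^ 2 - 4) / (D * D') := by
  rw [dist_add_left, dist_eq_norm, dist_eq_norm]
  have : D⁻¹ • (m • e + h • g) - D'⁻¹ • (m • e + h • g') =
      (m / D - m / D') • e + ((h / D) • g - (h / D') • g') := by
    simp only [div_eq_inv_mul]; module
  rw [this, norm_add_sq_real, norm_sub_sq_real, norm_sub_sq_real]
  have hge : ⟪e, g⟫ = 0 := by rw [real_inner_comm]; exact hg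
  have hge' : ⟪e, g'⟫ = 0 := by rw [real_inner_comm]; exact hg'
  simp only [norm_smul, inner_smul_left, inner_smul_right, inner_sub_right, mul_pow,
    hge, hge',
    he, Real.norm_eq_abs, sq_abs]
  have e1 : h ^ 2 * ‖g‖ ^ 2 = D - m ^ 2 + h ^ 2 := by rw [hD]; ring
  have e2 : h ^ 2 * ‖g'‖ ^ 2 = D' - m ^ 2 + h ^ 2 := by rw [hD']; ring
  simp only [conj_trivial]
  field_simp
  linear_combination (D' ^ 2 - D * D') * e1 + (D ^ 2 - D * D') * e2

end Helpers

/-- Given two tangent spheres of positive radius in `ℝⁿ` (`n ≥ 2`) and a finite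
set `Y` of points in `ℝ^{n-1}` with pairwise distances at least `2` (the centers
of a unit-sphere packing), there is an injective assignment of spheres of
positive radius to the points of `Y`, each tangent to both given spheres,
pairwise non-intersecting, and tangent exactly when the corresponding centers
are at distance `2`. -/
theorem kissing_arrangement_of_unit_packing
    (n : ℕ) (hn : 2 ≤ n)
    (c₁ c₂ : EuclideanSpace ℝ (Fin n)) (r₁ r₂ : ℝ)
    (hr₁ : 0 < r₁) (hr₂ : 0 < r₂)
    (htan : SpheresTangent (Metric.sphere c₁ r₁) (Metric.sphere c₂ r₂))
    (Y : Finset (EuclideanSpace ℝ (Fin (n - 1))))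
    (hY : ∀ y ∈ Y, ∀ z ∈ Y, y ≠ z → 2 ≤ dist y z) :
    ∃ (C : EuclideanSpace ℝ (Fin (n - 1)) → EuclideanSpace ℝ (Fin n))
      (ρ : EuclideanSpace ℝ (Fin (n - 1)) → ℝ),
      (∀ y ∈ Y, 0 < ρ y) ∧
      (∀ y ∈ Y, ∀ z ∈ Y, y ≠ z →
        Metric.sphere (C y) (ρ y) ≠ Metric.sphere (C z) (ρ z)) ∧
      (∀ y ∈ Y,
        SpheresTangent (Metric.sphere (C y) (ρ y)) (Metric.sphere c₁ r₁) ∧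
        SpheresTangent (Metric.sphere (C y) (ρ y)) (Metric.sphere c₂ r₂)) ∧
      (∀ y ∈ Y, ∀ z ∈ Y, y ≠ z →
        SpheresNonIntersecting (Metric.sphere (C y) (ρ y))
          (Metric.sphere (C z) (ρ z))) ∧
      (∀ y ∈ Y, ∀ z ∈ Y, y ≠ z →
        (SpheresTangent (Metric.sphere (C y) (ρ y)) (Metric.sphere (C z) (ρ z))
          ↔ dist y z = 2)) := by
  classical
  obtain ⟨p, e, a, b, he, rfl, rfl, ha, hb, hab⟩ := aux_line c₁ c₂ r₁ r₂ hr₁ hr₂ htan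
  subst ha hb
  have ha0 : a ≠ 0 := abs_pos.mp hr₁
  have hb0 : b ≠ 0 := abs_pos.mp hr₂
  obtain ⟨k, rfl⟩ : ∃ k, n = k + 1 := ⟨n - 1, by omega⟩
  have : Fact (Module.finrank ℝ (EuclideanSpace ℝ (Fin (k + 1))) = k + 1) := ⟨by simp⟩
  have he0 : e ≠ 0 := by
    intro h0
    rw [h0, norm_zero] at he
    exact zero_ne_one he
  obtain ⟨L, hL⟩ : ∃ L : EuclideanSpace ℝ (Fin (k + 1 - 1)) →ₗᵢ[ℝ] EuclideanSpace ℝ (Fin (k + 1)),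
      ∀ y, ⟪L y, e⟫ = 0 := by
    refine ⟨(Submodule.subtypeₗᵢ _).comp
      (OrthonormalBasis.fromOrthogonalSpanSingleton (𝕜 := ℝ) k he0).repr.symm.toLinearIsometry, ?_⟩
    intro y
    exact Submodule.mem_orthogonal_singleton_iff_inner_left.mp (Submodule.coe_mem _)
  have : Nonempty (Fin (k + 1 - 1)) := ⟨⟨0, by omega⟩⟩
  obtain ⟨t, ht⟩ : ∃ t : EuclideanSpace ℝ (Fin (k + 1 - 1)), ∀ y ∈ Y, 1 < ‖y + t‖ := by
    obtain ⟨t, ht⟩ := NormedSpace.exists_lt_norm ℝ (EuclideanSpace ℝ (Fin (k + 1 - 1)))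
      (1 + ∑ y ∈ Y, ‖y‖)
    refine ⟨t, fun y hy => ?_⟩
    have h1 : ‖y‖ ≤ ∑ y ∈ Y, ‖y‖ :=
      Finset.single_le_sum (f := fun y => ‖y‖) (fun _ _ => norm_nonneg _) hy
    have h2 : ‖t‖ ≤ ‖y + t‖ + ‖y‖ := by
      have := norm_sub_le (y + t) y
      rwa [add_sub_cancel_left] at this
    linarith
  obtain ⟨m, h, hh, hma, hmb⟩ : ∃ m h : ℝ, 0 < h ∧
      (1 - 2 * a * m = 2 * a * h ∨ 1 - 2 * a * m = - (2 * a * h)) ∧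
      (1 - 2 * b * m = 2 * b * h ∨ 1 - 2 * b * m = - (2 * b * h)) := by
    have hne : 1 / (2 * a) - 1 / (2 * b) ≠ 0 := by
      intro h0
      field_simp at h0
      apply hab
      linarith
    refine ⟨(1 / (2 * a) + 1 / (2 * b)) / 2, |1 / (2 * a) - 1 / (2 * b)| / 2, by positivity, ?_⟩
    rcases abs_cases (1 / (2 * a) - 1 / (2 * b)) with ⟨h1, -⟩ | ⟨h1, -⟩ <;> rw [h1]
    · exact ⟨Or.inl (by field_simp; ring), Or.inr (by field_simp; ring)⟩
    · exact ⟨Or.inr (by field_simp; ring), Or.inl (by field_simp; ring)⟩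
  let D : EuclideanSpace ℝ (Fin (k + 1 - 1)) → ℝ :=
    fun y => m ^ 2 + h ^ 2 * (‖L (y + t)‖ ^ 2 - 1)
  have hg : ∀ y ∈ Y, 1 < ‖L (y + t)‖ := fun y hy => by
    rw [L.norm_map]; exact ht y hy
  have hD : ∀ y ∈ Y, 0 < D y := fun y hy => by
    have h1 : 0 < ‖L (y + t)‖ ^ 2 - 1 := by nlinarith [hg y hy]
    have : 0 < h ^ 2 * (‖L (y + t)‖ ^ 2 - 1) := by positivity
    have := sq_nonneg m
    simp only [D]
    linarith
  have hρ : ∀ y ∈ Y, 0 < h / D y := fun y hy => div_pos hh (hD y hy)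
  have hpair : ∀ y ∈ Y, ∀ z ∈ Y,
      dist (p + (D y)⁻¹ • (m • e + h • L (y + t))) (p + (D z)⁻¹ • (m • e + h • L (z + t))) ^ 2 =
      (h / D y + h / D z) ^ 2 + h ^ 2 * (dist y z ^ 2 - 4) / (D y * D z) := fun y hy z hz => by
    rw [aux_pair p e _ _ he (hL _) (hL _) m h (D y) (D z) rfl (hD y hy) rfl (hD z hz),
      L.dist_map, dist_add_right]
  have htouch : ∀ y ∈ Y, ∀ z ∈ Y, dist y z = 2 → SpheresTangent
      (Metric.sphere (p + (D y)⁻¹ • (m • e + h • L (y + t))) (h / D y))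
      (Metric.sphere (p + (D z)⁻¹ • (m • e + h • L (z + t))) (h / D z)) := by
    intro y hy z hz h2
    have h3 := hpair y hy z hz
    rw [h2] at h3
    have h4 : h ^ 2 * ((2:ℝ) ^ 2 - 4) / (D y * D z) = 0 := by norm_num
    rw [h4, add_zero] at h3
    have := hρ y hy
    have h5 := hρ z hz
    have h6 := aux_tangent _ _ _ _ (hρ y hy) h3 (by
      intro h0
      rw [h0, dist_self] at h3
      nlinarith)
    rwa [abs_of_pos h5] at h6
  have hfar : ∀ y ∈ Y, ∀ z ∈ Y, 2 < dist y z →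
      (Metric.sphere (p + (D y)⁻¹ • (m • e + h • L (y + t))) (h / D y)) ∩
      (Metric.sphere (p + (D z)⁻¹ • (m • e + h • L (z + t))) (h / D z)) = ∅ := by
    intro y hy z hz h2
    apply aux_disjoint
    apply lt_of_pow_lt_pow_left₀ 2 dist_nonneg
    rw [hpair y hy z hz]
    have h3 : 0 < dist y z ^ 2 - 4 := by nlinarith
    have := hD y hy
    have := hD z hz
    have : 0 < h ^ 2 * (dist y z ^ 2 - 4) / (D y * D z) := by positivity
    linarith
  have hnon : ∀ y ∈ Y, ∀ z ∈ Y, y ≠ z → SpheresNonIntersecting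
      (Metric.sphere (p + (D y)⁻¹ • (m • e + h • L (y + t))) (h / D y))
      (Metric.sphere (p + (D z)⁻¹ • (m • e + h • L (z + t))) (h / D z)) := by
    intro y hy z hz hyz
    unfold SpheresNonIntersecting
    rcases (hY y hy z hz hyz).eq_or_lt with h2 | h2
    · obtain ⟨q, hq⟩ := htouch y hy z hz h2.symm
      rw [hq]; exact Set.subsingleton_singleton
    · rw [hfar y hy z hz h2]; exact Set.subsingleton_empty
  refine ⟨fun y => p + (D y)⁻¹ • (m • e + h • L (y + t)), fun y => h / D y, hρ, ?_, ?_, hnon, ?_⟩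
  · intro y hy z hz hyz
    exact aux_ne _ _ _ _ (hρ y hy) (NormedSpace.sphere_nonempty.mpr (hρ y hy).le)
      (hnon y hy z hz hyz)
  · intro y hy
    exact ⟨aux_base p e _ he (hL _) (hg y hy) a m h (D y) hh hma rfl (hD y hy),
      aux_base p e _ he (hL _) (hg y hy) b m h (D y) hh hmb rfl (hD y hy)⟩
  · intro y hy z hz hyz
    refine ⟨?_, htouch y hy z hz⟩
    rintro ⟨q, hq⟩
    by_contra h2
    have h3 := hfar y hy z hz (lt_of_le_of_ne (hY y hy z hz hyz) (Ne.symm h2))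
    rw [h3] at hq
    exact (Set.singleton_ne_empty q) hq.symm
end

section
/- Let d ≥ 2 and let c be a real number with −1/d ≤ c < 1. Let x₁, …, x_{d−1} be unit vectors in ℝ^d such that ⟪xᵢ, xⱼ⟫ = c for all i ≠ j. Then the set of unit vectors v in ℝ^d satisfying ⟪v, xᵢ⟫ = c for all i = 1, …, d−1 has exactly two elements. -/
open scoped RealInnerProductSpace

/-- Given `d - 1` unit vectors in `ℝ^d` with all pairwise inner products equal
to `c`, where `-1/d ≤ c < 1` (a regular spherical `(d-2)`-simplex), there are
exactly two unit vectors having inner product `c` with all of them (the two ways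
to complete it to a regular spherical `(d-1)`-simplex). -/
theorem two_adjacent_vertices
    (d : ℕ) (hd : 2 ≤ d) (c : ℝ) (hc₁ : -1 / (d : ℝ) ≤ c) (hc₂ : c < 1)
    (x : Fin (d - 1) → EuclideanSpace ℝ (Fin d))
    (hx : ∀ i, ‖x i‖ = 1)
    (hxc : ∀ i j, i ≠ j → ⟪x i, x j⟫ = c) :
    ∃ a b : EuclideanSpace ℝ (Fin d), a ≠ b ∧
      {v : EuclideanSpace ℝ (Fin d) | ‖v‖ = 1 ∧ ∀ i, ⟪v, x i⟫ = c} = {a, b} := by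
  have hd0 : (2:ℝ) ≤ d := by exact_mod_cast hd
  have hdpos : (0:ℝ) < d := by linarith
  have hcd : -1 ≤ c * d := by rwa [div_le_iff₀ hdpos] at hc₁
  have hcard : ((d - 1 : ℕ) : ℝ) = (d:ℝ) - 1 := by
    rw [Nat.cast_sub (by omega)]; simp
  have hG : ∀ i j, ⟪x i, x j⟫ = (if i = j then (1 - c) else 0) + c := by
    intro i j
    split_ifs with h
    · subst h
      rw [real_inner_self_eq_norm_sq, hx]; ring
    · rw [hxc i j h]; ring
  obtain ⟨D, hD⟩ : ∃ D : ℝ, D = (1 - c) + ((d:ℝ) - 1) * c := ⟨_, rfl⟩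
  have hDpos : 0 < D := by
    have : 0 < D * d := by rw [hD]; nlinarith
    exact pos_of_mul_pos_left this hdpos.le
  have hlin : ∀ (g : Fin (d - 1) → ℝ) j,
      ⟪∑ i, g i • x i, x j⟫ = (1 - c) * g j + c * ∑ i, g i := by
    intro g j
    simp only [sum_inner, real_inner_smul_left, hG, mul_add, Finset.sum_add_distrib,
      mul_ite, mul_zero, Finset.sum_ite_eq', Finset.mem_univ, if_true, ← Finset.sum_mul]
    ring
  have hli : LinearIndependent ℝ x := by
    rw [Fintype.linearIndependent_iff]
    intro g hg
    have h1 : ∀ j, (1 - c) * g j + c * ∑ i, g i = 0 := by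
      intro j
      rw [← hlin, hg, inner_zero_left]
    have h2 : D * ∑ i, g i = 0 := by
      have h3 : ∑ j, ((1 - c) * g j + c * ∑ i, g i) = 0 := by simp [h1]
      rw [Finset.sum_add_distrib, ← Finset.mul_sum, Finset.sum_const, Finset.card_univ,
        Fintype.card_fin, nsmul_eq_mul, hcard] at h3
      rw [hD]; linarith
    have h4 : ∑ i, g i = 0 := (mul_eq_zero.mp h2).resolve_left hDpos.ne'
    intro i
    have h5 := h1 i
    rw [h4, mul_zero, add_zero] at h5
    exact (mul_eq_zero.mp h5).resolve_left (by linarith)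
  obtain ⟨W, hW⟩ : ∃ W, W = Submodule.span ℝ (Set.range x) := ⟨_, rfl⟩
  have hWr : Module.finrank ℝ W = d - 1 := by
    rw [hW, finrank_span_eq_card hli, Fintype.card_fin]
  have hWo : Module.finrank ℝ Wᗮ = 1 := by
    have := W.finrank_add_finrank_orthogonal
    rw [hWr, finrank_euclideanSpace_fin] at this
    omega
  have hmem : ∀ v, v ∈ Wᗮ ↔ ∀ i, ⟪v, x i⟫ = 0 := by
    intro v
    rw [Submodule.mem_orthogonal']
    constructor
    · intro h i
      exact h _ (hW ▸ Submodule.subset_span ⟨i, rfl⟩)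
    · intro h u hu
      rw [hW] at hu
      induction hu using Submodule.span_induction with
      | mem y hy => obtain ⟨i, rfl⟩ := hy; exact h i
      | zero => exact inner_zero_right _
      | add y z _ _ hy hz => rw [inner_add_right, hy, hz, add_zero]
      | smul a y _ hy => rw [real_inner_smul_right, hy, mul_zero]
  obtain ⟨w, hw0, hw⟩ := finrank_eq_one_iff'.mp hWo
  obtain ⟨p, hp⟩ : ∃ p, p = ∑ i, (c / D) • x i := ⟨_, rfl⟩
  have hpx : ∀ j, ⟪p, x j⟫ = c := by
    intro j
    rw [hp, hlin, Finset.sum_const, Finset.card_univ, Fintype.card_fin, nsmul_eq_mul, hcard]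
    have : (1 - c) * (c / D) + c * (((d:ℝ) - 1) * (c / D)) = (c / D) * D := by rw [hD]; ring
    rw [this, div_mul_cancel₀ _ hDpos.ne']
  have hpp : ⟪p, p⟫ < 1 := by
    have : ⟪p, p⟫ = ((d:ℝ) - 1) * c ^ 2 / D := by
      conv_lhs => rw [hp, ← hp]
      nth_rewrite 2 [hp]
      simp only [inner_sum, real_inner_smul_right, hpx, Finset.sum_const, Finset.card_univ,
        Fintype.card_fin, nsmul_eq_mul, hcard]
      ring
    rw [this, div_lt_one hDpos, hD]
    have h1 : 0 < ((d:ℝ) - 1) * c + 1 := by nlinarith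
    nlinarith [mul_pos h1 (sub_pos.mpr hc₂)]
  have hpw : ⟪p, (w : EuclideanSpace ℝ (Fin d))⟫ = 0 := by
    rw [hp, sum_inner]
    refine Finset.sum_eq_zero fun i _ => ?_
    rw [real_inner_smul_left, real_inner_comm, (hmem w).mp w.2 i, mul_zero]
  have hwpos : 0 < ⟪(w : EuclideanSpace ℝ (Fin d)), (w : EuclideanSpace ℝ (Fin d))⟫ := by
    apply real_inner_self_pos.mpr
    simpa using hw0
  have hnorm : ∀ t : ℝ, ‖p + t • (w : EuclideanSpace ℝ (Fin d))‖ = 1 ↔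
      t ^ 2 = (1 - ⟪p, p⟫) / ⟪(w : EuclideanSpace ℝ (Fin d)), (w : EuclideanSpace ℝ (Fin d))⟫ := by
    intro t
    rw [← sq_eq_sq₀ (norm_nonneg _) zero_le_one, ← real_inner_self_eq_norm_sq,
      real_inner_add_add_self, real_inner_smul_right, hpw, real_inner_smul_left,
      real_inner_smul_right, eq_div_iff hwpos.ne']
    constructor <;> intro h <;> linarith
  obtain ⟨q, hq⟩ : ∃ q : ℝ, q = (1 - ⟪p, p⟫) /
      ⟪(w : EuclideanSpace ℝ (Fin d)), (w : EuclideanSpace ℝ (Fin d))⟫ := ⟨_, rfl⟩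
  have hqpos : 0 < q := by rw [hq]; exact div_pos (by linarith) hwpos
  have hs := Real.sqrt_pos.mpr hqpos
  have hs2 := Real.sq_sqrt hqpos.le
  have hwx := (hmem w).mp w.2
  refine ⟨p + (√q) • (w : EuclideanSpace ℝ (Fin d)),
    p + (-√q) • (w : EuclideanSpace ℝ (Fin d)), ?_, ?_⟩
  · intro h
    have h1 := smul_left_injective ℝ (show (w : EuclideanSpace ℝ (Fin d)) ≠ 0 by simpa using hw0)
      (add_left_cancel h)
    linarith
  · ext v
    simp only [Set.mem_setOf_eq, Set.mem_insert_iff, Set.mem_singleton_iff]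
    constructor
    · rintro ⟨hv1, hv2⟩
      have hm : v - p ∈ Wᗮ := by
        rw [hmem]; intro i; rw [inner_sub_left, hv2, hpx, sub_self]
      obtain ⟨t, ht⟩ := hw ⟨v - p, hm⟩
      have ht' : t • (w : EuclideanSpace ℝ (Fin d)) = v - p := congrArg Subtype.val ht
      have hv : v = p + t • (w : EuclideanSpace ℝ (Fin d)) := by rw [ht']; abel
      rw [hv, hnorm, ← hq, ← hs2, sq_eq_sq_iff_eq_or_eq_neg] at hv1
      rcases hv1 with h | h
      · left; rw [hv, h]
      · right; rw [hv, h]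
    · rintro (h | h)
      · subst h
        refine ⟨(hnorm _).mpr (by rw [← hq, hs2]), fun i => ?_⟩
        rw [inner_add_left, real_inner_smul_left, hwx, hpx]; ring
      · subst h
        refine ⟨(hnorm _).mpr (by rw [← hq, neg_sq, hs2]), fun i => ?_⟩
        rw [inner_add_left, real_inner_smul_left, hwx, hpx]; ring
end

section
/- Let d ≥ 1 and let X be a finite set of unit vectors in ℝ^d such that ⟪x, y⟫ ≤ 0 for all distinct x, y ∈ X. Then X has at most 2d elements. -/
open scoped RealInnerProductSpace

theorem code_aux {ι E : Type*} [DecidableEq ι] [NormedAddCommGroup E] [InnerProductSpace ℝ E]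
    [FiniteDimensional ℝ E] (n : ℕ) : ∀ (K : Submodule ℝ E), Module.finrank ℝ K ≤ n →
    ∀ (s : Finset ι) (v : ι → E), (∀ i ∈ s, v i ∈ K) → (∀ i ∈ s, v i ≠ 0) →
    (∀ i ∈ s, ∀ j ∈ s, i ≠ j → ⟪v i, v j⟫ ≤ 0) → s.card ≤ 2 * n := by
  classical
  induction n with
  | zero =>
    intro K hK s v hv h0 _
    have hb : K = ⊥ := Submodule.finrank_eq_zero.mp (Nat.le_zero.mp hK)
    have : s = ∅ := by
      apply Finset.eq_empty_of_forall_notMem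
      intro i hi
      have := hv i hi
      rw [hb, Submodule.mem_bot] at this
      exact h0 i hi this
    simp [this]
  | succ n ih =>
    intro K hK s v hv h0 hs
    rcases s.eq_empty_or_nonempty with rfl | ⟨a, ha⟩
    · simp
    set x := v a with hx
    have hxx : 0 < ⟪x, x⟫ := real_inner_self_pos.mpr (h0 a ha)
    let c : ι → ℝ := fun i => ⟪x, v i⟫ / ⟪x, x⟫
    let w : ι → E := fun i => v i - c i • x
    have hc : ∀ i ∈ s.erase a, c i ≤ 0 := fun i hi =>
      div_nonpos_of_nonpos_of_nonneg
        (hs a ha i (Finset.mem_of_mem_erase hi) (Finset.ne_of_mem_erase hi).symm) hxx.le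
    have hcm : ∀ i, c i * ⟪x, x⟫ = ⟪x, v i⟫ := fun i => div_mul_cancel₀ _ hxx.ne'
    have hxw : ∀ i, ⟪x, w i⟫ = 0 := by
      intro i
      simp only [w, inner_sub_right, inner_smul_right]
      rw [hcm]; ring
    have hww : ∀ i j, ⟪w i, w j⟫ = ⟪v i, v j⟫ - c i * c j * ⟪x, x⟫ := by
      intro i j
      have h1 : ⟪w i, w j⟫ = ⟪v i, w j⟫ - c i * ⟪x, w j⟫ := by
        conv_lhs => rw [show w i = v i - c i • x from rfl]
        rw [inner_sub_left, real_inner_smul_left]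
      rw [h1, hxw]
      simp only [w, inner_sub_right, inner_smul_right]
      rw [real_inner_comm x (v i), ← hcm i]; ring
    have hlt : Module.finrank ℝ (K ⊓ (ℝ ∙ x)ᗮ : Submodule ℝ E) < Module.finrank ℝ K := by
      apply Submodule.finrank_lt_finrank_of_lt
      refine lt_of_le_of_ne inf_le_left fun h => ?_
      have h2 : x ∈ K ⊓ (ℝ ∙ x)ᗮ := by rw [h]; exact hv a ha
      have h3 := Submodule.mem_orthogonal_singleton_iff_inner_right.mp h2.2
      exact hxx.ne' h3
    have h1 := ih (K ⊓ (ℝ ∙ x)ᗮ) (by omega) ((s.erase a).filter (fun i => w i ≠ 0)) w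
      (fun i hi => by
        have hi' := Finset.mem_of_mem_erase (Finset.mem_filter.mp hi).1
        exact ⟨K.sub_mem (hv i hi') (K.smul_mem _ (hv a ha)),
          Submodule.mem_orthogonal_singleton_iff_inner_right.mpr (hxw i)⟩)
      (fun i hi => (Finset.mem_filter.mp hi).2)
      (fun i hi j hj hij => by
        have hi' := (Finset.mem_filter.mp hi).1
        have hj' := (Finset.mem_filter.mp hj).1
        rw [hww]
        have := hs i (Finset.mem_of_mem_erase hi') j (Finset.mem_of_mem_erase hj') hij
        have := mul_nonneg (mul_nonneg_of_nonpos_of_nonpos (hc i hi') (hc j hj')) hxx.le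
        linarith)
    have h2 : ((s.erase a).filter (fun i => ¬ w i ≠ 0)).card ≤ 1 := by
      rw [Finset.card_le_one]
      intro i hi j hj
      by_contra hij
      obtain ⟨hi1, hi2⟩ := Finset.mem_filter.mp hi
      obtain ⟨hj1, hj2⟩ := Finset.mem_filter.mp hj
      rw [not_not] at hi2 hj2
      have key : ∀ k ∈ s.erase a, w k = 0 → c k < 0 := by
        intro k hk hk0
        refine lt_of_le_of_ne (hc k hk) fun h => h0 k (Finset.mem_of_mem_erase hk) ?_
        have : v k - c k • x = 0 := hk0
        simpa [h] using this
      have e := hww i j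
      rw [hi2, inner_zero_left] at e
      have := hs i (Finset.mem_of_mem_erase hi1) j (Finset.mem_of_mem_erase hj1) hij
      have := mul_pos (mul_pos_of_neg_of_neg (key i hi1 hi2) (key j hj1 hj2)) hxx
      linarith
    have h3 := Finset.card_filter_add_card_filter_not (s := s.erase a) (fun i => w i ≠ 0)
    have h4 := Finset.card_erase_add_one ha
    omega

/-- A set of unit vectors in `ℝ^d` with all pairwise inner products at most `0`
(a spherical `π/2`-code) has at most `2d` elements: `A(d, π/2) ≤ 2d`. -/
theorem orthogonal_code_card_le
    (d : ℕ) (hd : 1 ≤ d)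
    (X : Finset (EuclideanSpace ℝ (Fin d)))
    (hX : ∀ x ∈ X, ‖x‖ = 1)
    (hcode : ∀ x ∈ X, ∀ y ∈ X, x ≠ y → ⟪x, y⟫ ≤ 0) :
    X.card ≤ 2 * d := by
  classical
  refine code_aux d ⊤ (by simp) X id (fun _ _ => trivial) (fun x hx h => ?_) hcode
  have := hX x hx
  have h' : x = 0 := h
  simp [h'] at this
end

section
/- Every finite set X of unit vectors in ℝ² such that ⟪x, y⟫ ≤ 1/2 for all distinct x, y ∈ X has at most 6 elements; moreover, there exists such a set with exactly 6 elements (the vertices of a regular hexagon). Hence A(2, π/3) = 6. -/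
open scoped RealInnerProductSpace

def hexA : Fin 6 → ℤ := ![2, 1, -1, -2, -1, 1]
def hexB : Fin 6 → ℤ := ![0, 1, 1, 0, -1, -1]

noncomputable def hexP (i : Fin 6) : EuclideanSpace ℝ (Fin 2) :=
  !₂[(hexA i : ℝ) / 2, (hexB i : ℝ) * √3 / 2]

lemma hexP_inner (i j : Fin 6) :
    ⟪hexP i, hexP j⟫ = ((hexA i * hexA j + 3 * (hexB i * hexB j) : ℤ) : ℝ) / 4 := by
  have h3 : √3 * √3 = (3 : ℝ) := Real.mul_self_sqrt (by norm_num)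
  simp only [hexP, PiLp.inner_apply, Fin.sum_univ_two, RCLike.inner_apply, conj_trivial]
  simp
  linear_combination ((hexB i : ℝ) * hexB j / 4) * h3

lemma hexP_self (i : Fin 6) : ⟪hexP i, hexP i⟫ = 1 := by
  have h : ∀ i, hexA i * hexA i + 3 * (hexB i * hexB i) = 4 := by decide
  rw [hexP_inner, h]; norm_num

lemma hexP_ne (i j : Fin 6) (hij : i ≠ j) : ⟪hexP i, hexP j⟫ ≤ 1 / 2 := by
  have h : ∀ i j, i ≠ j → hexA i * hexA j + 3 * (hexB i * hexB j) ≤ 2 := by decide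
  have h' : ((hexA i * hexA j + 3 * (hexB i * hexB j) : ℤ) : ℝ) ≤ 2 := by
    exact_mod_cast h i j hij
  rw [hexP_inner]; linarith

lemma hexP_inj : Function.Injective hexP := by
  intro i j h
  by_contra hij
  have h1 := hexP_ne i j hij
  rw [← h, hexP_self] at h1
  norm_num at h1

noncomputable def hexArg (x : EuclideanSpace ℝ (Fin 2)) : ℝ := Complex.arg ⟨x 0, x 1⟩

lemma hexArg_spec (x : EuclideanSpace ℝ (Fin 2)) (hx : ‖x‖ = 1) :
    x 0 = Real.cos (hexArg x) ∧ x 1 = Real.sin (hexArg x) := by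
  have hn : ‖(⟨x 0, x 1⟩ : ℂ)‖ = 1 := by
    rw [EuclideanSpace.norm_eq, Fin.sum_univ_two] at hx
    rw [Complex.norm_eq_sqrt_sq_add_sq]
    simpa using hx
  have h1 := Complex.norm_mul_cos_arg (⟨x 0, x 1⟩ : ℂ)
  have h2 := Complex.norm_mul_sin_arg (⟨x 0, x 1⟩ : ℂ)
  rw [hn, one_mul] at h1 h2
  exact ⟨h1.symm, h2.symm⟩

lemma hex_inner (x y : EuclideanSpace ℝ (Fin 2)) (hx : ‖x‖ = 1) (hy : ‖y‖ = 1) :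
    ⟪x, y⟫ = Real.cos (hexArg x - hexArg y) := by
  obtain ⟨a, b⟩ := hexArg_spec x hx
  obtain ⟨c, d⟩ := hexArg_spec y hy
  simp only [PiLp.inner_apply, Fin.sum_univ_two, RCLike.inner_apply, conj_trivial]
  rw [Real.cos_sub, a, b, c, d]; ring

/-- `A(2, π/3) = 6`: every set of unit vectors in `ℝ²` with pairwise inner
products at most `1/2` has at most `6` elements, and there is such a set with
exactly `6` elements (the vertices of a regular hexagon). -/
theorem hexagon_code :
    (∀ X : Finset (EuclideanSpace ℝ (Fin 2)),
      (∀ x ∈ X, ‖x‖ = 1) →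
      (∀ x ∈ X, ∀ y ∈ X, x ≠ y → ⟪x, y⟫ ≤ 1 / 2) →
      X.card ≤ 6) ∧
    (∃ X : Finset (EuclideanSpace ℝ (Fin 2)),
      (∀ x ∈ X, ‖x‖ = 1) ∧
      (∀ x ∈ X, ∀ y ∈ X, x ≠ y → ⟪x, y⟫ ≤ 1 / 2) ∧
      X.card = 6) := by
  have hpi := Real.pi_pos
  constructor
  · intro X hX hXY
    have key : X.card ≤ (Finset.Icc (-2 : ℤ) 3).card := by
      apply Finset.card_le_card_of_injOn (fun x => ⌈hexArg x / (Real.pi / 3)⌉)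
      · intro x hx
        have h1 : -Real.pi < hexArg x := Complex.neg_pi_lt_arg _
        have h2 : hexArg x ≤ Real.pi := Complex.arg_le_pi _
        have h3 : (-3 : ℤ) < ⌈hexArg x / (Real.pi / 3)⌉ := by
          rw [Int.lt_ceil, lt_div_iff₀ (by positivity)]
          push_cast; linarith
        have h4 : ⌈hexArg x / (Real.pi / 3)⌉ ≤ 3 := by
          rw [Int.ceil_le, div_le_iff₀ (by positivity)]
          push_cast; linarith
        simp only [Finset.coe_Icc, Set.mem_Icc]
        omega
      · intro x hx y hy hxy
        by_contra hne
        have h := hXY x hx y hy hne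
        rw [hex_inner x y (hX x hx) (hX y hy), ← Real.cos_abs] at h
        simp only at hxy
        have a1 := Int.le_ceil (hexArg x / (Real.pi / 3))
        have a2 := Int.ceil_lt_add_one (hexArg x / (Real.pi / 3))
        have b1 := Int.le_ceil (hexArg y / (Real.pi / 3))
        have b2 := Int.ceil_lt_add_one (hexArg y / (Real.pi / 3))
        rw [hxy] at a1 a2
        have hd : |hexArg x / (Real.pi / 3) - hexArg y / (Real.pi / 3)| < 1 := by
          rw [abs_lt]; constructor <;> linarith
        rw [← sub_div, abs_div, abs_of_pos (show 0 < Real.pi / 3 by positivity),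
          div_lt_one (by positivity)] at hd
        have := Real.cos_lt_cos_of_nonneg_of_le_pi (abs_nonneg _) (by linarith) hd
        rw [Real.cos_pi_div_three] at this
        linarith
    simpa using key
  · refine ⟨Finset.univ.map ⟨hexP, hexP_inj⟩, ?_, ?_, by simp⟩
    · intro x hx
      obtain ⟨i, -, rfl⟩ := Finset.mem_map.1 hx
      have := hexP_self i
      rw [real_inner_self_eq_norm_sq] at this
      exact (pow_eq_one_iff_of_nonneg (norm_nonneg _) two_ne_zero).1 this
    · intro x hx y hy hxy
      obtain ⟨i, -, rfl⟩ := Finset.mem_map.1 hx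
      obtain ⟨j, -, rfl⟩ := Finset.mem_map.1 hy
      exact hexP_ne i j (fun h => hxy (by rw [h]))
end

section
/- Let S be a sphere of positive radius r in Euclidean n-space (n ≥ 2) passing through a point p, and let R > 0. Then the image of S \ {p} under the inversion with center p and radius R is an affine hyperplane not containing p; that is, there exist a nonzero vector v and a real number t ≠ 0 such that the image of S \ {p} under the inversion equals { y : ⟪v, y − p⟫ = t }. -/
open scoped RealInnerProductSpace

/-- The image of a sphere of positive radius passing through `p`, with the
point `p` removed, under the inversion with center `p` and radius `R > 0`, is
an affine hyperplane not containing `p`. -/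
theorem inversion_sphere_through_center_eq_hyperplane
    (n : ℕ) (hn : 2 ≤ n)
    (c p : EuclideanSpace ℝ (Fin n)) (r : ℝ) (hr : 0 < r)
    (hp : p ∈ Metric.sphere c r)
    (R : ℝ) (hR : 0 < R) :
    ∃ v : EuclideanSpace ℝ (Fin n), v ≠ 0 ∧ ∃ t : ℝ, t ≠ 0 ∧
      EuclideanGeometry.inversion p R '' (Metric.sphere c r \ {p}) =
        {y : EuclideanSpace ℝ (Fin n) | ⟪v, y - p⟫ = t} := by
  have hd : dist c p = r := by rw [dist_comm]; exact hp
  have hcp : c ≠ p := by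
    intro h
    rw [h, dist_self] at hd
    exact hr.ne hd
  have hR' : R ≠ 0 := hR.ne'
  have hq : EuclideanGeometry.inversion p R c ≠ p :=
    fun h => hcp ((EuclideanGeometry.inversion_eq_center hR').1 h)
  refine ⟨EuclideanGeometry.inversion p R c - p, sub_ne_zero.2 hq,
    dist p (EuclideanGeometry.inversion p R c) ^ 2 / 2, ?_, ?_⟩
  · have := dist_pos.2 hq.symm
    positivity
  · rw [← hd, ← EuclideanGeometry.preimage_inversion_perpBisector_inversion hR' hcp,
      Set.image_preimage_eq _ (EuclideanGeometry.inversion_surjective p hR')]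
    ext y
    rw [SetLike.mem_coe, AffineSubspace.mem_perpBisector_iff_inner_eq, Set.mem_setOf_eq,
      real_inner_comm, vsub_eq_sub, vsub_eq_sub]
end

section
/- Let S₁ and S₂ be two disjoint spheres of positive radius in Euclidean n-space (n ≥ 2), i.e., S₁ ∩ S₂ = ∅. Then there exist a point p not lying on S₁ ∪ S₂ and a radius R > 0 such that the images of S₁ and S₂ under the inversion with center p and radius R are concentric spheres: there exist a point c and radii r₁′, r₂′ > 0 such that the image of S₁ is the sphere of center c and radius r₁′ and the image of S₂ is the sphere of center c and radius r₂′. -/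
open scoped RealInnerProductSpace

theorem inv_mem_aux {n : ℕ} (p c x : EuclideanSpace ℝ (Fin n)) (r k : ℝ) (hr : 0 < r)
    (hk : k = ‖c - p‖ ^ 2 - r ^ 2) (hk0 : k ≠ 0) (hx : x ∈ Metric.sphere c r) :
    EuclideanGeometry.inversion p 1 x ∈ Metric.sphere (p + k⁻¹ • (c - p)) (r / |k|) := by
  obtain ⟨w, rfl⟩ : ∃ w, x = p + w := ⟨x - p, by simp⟩
  obtain ⟨q, rfl⟩ : ∃ q, c = p + q := ⟨c - p, by simp⟩
  simp only [add_sub_cancel_left] at *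
  rw [mem_sphere_iff_norm] at *
  rw [add_sub_add_left_eq_sub] at hx
  have h1 : ‖w‖ ^ 2 - 2 * ⟪w, q⟫ + ‖q‖ ^ 2 = r ^ 2 := by
    rw [← norm_sub_sq_real, hx]
  have hw : w ≠ 0 := by
    rintro rfl
    apply hk0
    simp at h1
    rw [hk, ← h1]; ring_nf
  have hw' : ‖w‖ ≠ 0 := norm_ne_zero_iff.mpr hw
  have e : EuclideanGeometry.inversion p 1 (p + w) - (p + k⁻¹ • q)
      = ((‖w‖ ^ 2)⁻¹) • w - k⁻¹ • q := by
    simp [EuclideanGeometry.inversion]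
    abel
  rw [e]
  have hpos : 0 < |k| := abs_pos.mpr hk0
  rw [← sq_eq_sq₀ (norm_nonneg _) (by positivity), norm_sub_sq_real, norm_smul, norm_smul,
    real_inner_smul_left, real_inner_smul_right, div_pow, sq_abs, mul_pow, mul_pow,
    Real.norm_eq_abs, Real.norm_eq_abs, sq_abs, sq_abs]
  have h2 : ⟪w, q⟫ = (‖w‖ ^ 2 + k) / 2 := by rw [hk]; linarith
  have h3 : ‖q‖ ^ 2 = k + r ^ 2 := by rw [hk]; ring
  rw [h2, h3]
  field_simp
  ring

theorem inv_image_aux {n : ℕ} (p c : EuclideanSpace ℝ (Fin n)) (r k : ℝ) (hr : 0 < r)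
    (hk : k = ‖c - p‖ ^ 2 - r ^ 2) (hk0 : k ≠ 0) :
    EuclideanGeometry.inversion p 1 '' Metric.sphere c r
      = Metric.sphere (p + k⁻¹ • (c - p)) (r / |k|) := by
  have hpos : 0 < |k| := abs_pos.mpr hk0
  apply Set.Subset.antisymm
  · rintro _ ⟨x, hx, rfl⟩
    exact inv_mem_aux p c x r k hr hk hk0 hx
  · intro y hy
    refine ⟨EuclideanGeometry.inversion p 1 y, ?_,
      EuclideanGeometry.inversion_inversion p one_ne_zero y⟩
    have := inv_mem_aux p _ y (r / |k|) k⁻¹ (by positivity) (by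
      rw [add_sub_cancel_left, norm_smul, mul_pow, Real.norm_eq_abs, sq_abs, div_pow, sq_abs]
      have h3 : ‖c - p‖ ^ 2 = k + r ^ 2 := by rw [hk]; ring
      rw [h3]
      field_simp
      ring) (inv_ne_zero hk0) hy
    have e1 : p + k⁻¹⁻¹ • (p + k⁻¹ • (c - p) - p) = c := by
      rw [add_sub_cancel_left, smul_smul, inv_inv, mul_inv_cancel₀ hk0, one_smul]
      abel
    have e2 : r / |k| / |k⁻¹| = r := by
      rw [abs_inv]; field_simp
    rwa [e1, e2] at this

theorem exists_orth_aux {n : ℕ} (hn : 2 ≤ n) (u : EuclideanSpace ℝ (Fin n)) :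
    ∃ v : EuclideanSpace ℝ (Fin n), ‖v‖ = 1 ∧ ⟪u, v⟫ = 0 := by
  have h1 := Submodule.finrank_add_finrank_orthogonal (𝕜 := ℝ) (Submodule.span ℝ {u})
  have h2 := finrank_span_le_card (R := ℝ) ({u} : Set (EuclideanSpace ℝ (Fin n)))
  rw [Set.toFinset_singleton, Finset.card_singleton] at h2
  rw [finrank_euclideanSpace_fin] at h1
  have h3 : (Submodule.span ℝ {u})ᗮ ≠ ⊥ := by
    intro h
    rw [h, finrank_bot] at h1
    omega
  obtain ⟨v, hv, hv0⟩ := Submodule.exists_mem_ne_zero_of_ne_bot h3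
  refine ⟨‖v‖⁻¹ • v, ?_, ?_⟩
  · rw [norm_smul, norm_inv, norm_norm, inv_mul_cancel₀ (norm_ne_zero_iff.mpr hv0)]
  · rw [real_inner_smul_right, Submodule.mem_orthogonal_singleton_iff_inner_right.mp hv, mul_zero]

theorem disc_pos_aux {n : ℕ} (hn : 2 ≤ n) (c u : EuclideanSpace ℝ (Fin n)) (hu : u ≠ 0)
    (r₁ r₂ : ℝ) (hr₁ : 0 < r₁) (hr₂ : 0 < r₂)
    (hdisj : Metric.sphere c r₁ ∩ Metric.sphere (c + u) r₂ = ∅) :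
    0 < (‖u‖ ^ 2 + r₁ ^ 2 - r₂ ^ 2) ^ 2 - 4 * ‖u‖ ^ 2 * r₁ ^ 2 := by
  by_contra! hneg
  obtain ⟨v, hv, huv⟩ := exists_orth_aux hn u
  have hd : 0 < ‖u‖ := norm_pos_iff.mpr hu
  obtain ⟨a, ha⟩ : ∃ a, 2 * ‖u‖ ^ 2 * a = ‖u‖ ^ 2 + r₁ ^ 2 - r₂ ^ 2 :=
    ⟨(‖u‖ ^ 2 + r₁ ^ 2 - r₂ ^ 2) / (2 * ‖u‖ ^ 2), by field_simp⟩
  have hb : 0 ≤ r₁ ^ 2 - a ^ 2 * ‖u‖ ^ 2 := by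
    rw [← ha] at hneg
    have : 0 ≤ (4 * ‖u‖ ^ 2) * (r₁ ^ 2 - a ^ 2 * ‖u‖ ^ 2) := by nlinarith
    exact nonneg_of_mul_nonneg_right this (by positivity)
  obtain ⟨b, hb'⟩ : ∃ b : ℝ, b ^ 2 = r₁ ^ 2 - a ^ 2 * ‖u‖ ^ 2 := ⟨_, Real.sq_sqrt hb⟩
  have key : ∀ s : ℝ, ‖s • u + b • v‖ ^ 2 = s ^ 2 * ‖u‖ ^ 2 + b ^ 2 := by
    intro s
    rw [norm_add_sq_real, norm_smul, norm_smul, real_inner_smul_left, real_inner_smul_right,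
      huv, hv, mul_pow, mul_pow, Real.norm_eq_abs, Real.norm_eq_abs, sq_abs, sq_abs]
    ring
  have : c + (a • u + b • v) ∈ Metric.sphere c r₁ ∩ Metric.sphere (c + u) r₂ := by
    constructor
    · rw [mem_sphere_iff_norm, add_sub_cancel_left, ← sq_eq_sq₀ (norm_nonneg _) hr₁.le, key, hb']
      ring
    · have e : c + (a • u + b • v) - (c + u) = (a - 1) • u + b • v := by
        rw [sub_smul, one_smul]; abel
      rw [mem_sphere_iff_norm, e, ← sq_eq_sq₀ (norm_nonneg _) hr₂.le, key, hb']
      linarith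
  rw [hdisj] at this
  exact this

theorem assemble_aux {n : ℕ} (c₁ c₂ p : EuclideanSpace ℝ (Fin n)) (r₁ r₂ k₁ k₂ : ℝ)
    (hr₁ : 0 < r₁) (hr₂ : 0 < r₂)
    (hk₁ : k₁ = ‖c₁ - p‖ ^ 2 - r₁ ^ 2) (hk₂ : k₂ = ‖c₂ - p‖ ^ 2 - r₂ ^ 2)
    (h₁ : k₁ ≠ 0) (h₂ : k₂ ≠ 0) (hc : k₁⁻¹ • (c₁ - p) = k₂⁻¹ • (c₂ - p)) :
    ∃ (p : EuclideanSpace ℝ (Fin n)) (R : ℝ), 0 < R ∧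
      p ∉ Metric.sphere c₁ r₁ ∪ Metric.sphere c₂ r₂ ∧
      ∃ (c : EuclideanSpace ℝ (Fin n)) (r₁' r₂' : ℝ), 0 < r₁' ∧ 0 < r₂' ∧
        EuclideanGeometry.inversion p R '' Metric.sphere c₁ r₁ =
          Metric.sphere c r₁' ∧
        EuclideanGeometry.inversion p R '' Metric.sphere c₂ r₂ =
          Metric.sphere c r₂' := by
  refine ⟨p, 1, one_pos, ?_, p + k₁⁻¹ • (c₁ - p), r₁ / |k₁|, r₂ / |k₂|,
    div_pos hr₁ (abs_pos.mpr h₁), div_pos hr₂ (abs_pos.mpr h₂),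
    inv_image_aux p c₁ r₁ k₁ hr₁ hk₁ h₁, ?_⟩
  · rintro (h | h) <;> rw [mem_sphere_iff_norm, norm_sub_rev] at h
    · rw [h] at hk₁; exact h₁ (by rw [hk₁]; ring)
    · rw [h] at hk₂; exact h₂ (by rw [hk₂]; ring)
  · rw [hc]; exact inv_image_aux p c₂ r₂ k₂ hr₂ hk₂ h₂

/-- Any two disjoint spheres of positive radius in `ℝⁿ` (`n ≥ 2`) can be
inverted into a pair of concentric spheres: there are a center of inversion `p`
not on either sphere and a radius `R > 0` such that the images of the two
spheres under the inversion are spheres with a common center. -/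
theorem inversion_to_concentric_spheres
    (n : ℕ) (hn : 2 ≤ n)
    (c₁ c₂ : EuclideanSpace ℝ (Fin n)) (r₁ r₂ : ℝ)
    (hr₁ : 0 < r₁) (hr₂ : 0 < r₂)
    (hdisj : Metric.sphere c₁ r₁ ∩ Metric.sphere c₂ r₂ = ∅) :
    ∃ (p : EuclideanSpace ℝ (Fin n)) (R : ℝ), 0 < R ∧
      p ∉ Metric.sphere c₁ r₁ ∪ Metric.sphere c₂ r₂ ∧
      ∃ (c : EuclideanSpace ℝ (Fin n)) (r₁' r₂' : ℝ), 0 < r₁' ∧ 0 < r₂' ∧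
        EuclideanGeometry.inversion p R '' Metric.sphere c₁ r₁ =
          Metric.sphere c r₁' ∧
        EuclideanGeometry.inversion p R '' Metric.sphere c₂ r₂ =
          Metric.sphere c r₂' := by
  obtain ⟨u, rfl⟩ : ∃ u, c₂ = c₁ + u := ⟨c₂ - c₁, by simp⟩
  by_cases hu : u = 0
  · subst hu
    rw [add_zero] at hdisj ⊢
    refine assemble_aux c₁ c₁ c₁ r₁ r₂ (-r₁ ^ 2) (-r₂ ^ 2) hr₁ hr₂ (by simp) (by simp)
      (by simp [hr₁.ne']) (by simp [hr₂.ne']) (by simp)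
  have hD := disc_pos_aux hn c₁ u hu r₁ r₂ hr₁ hr₂ hdisj
  have hd : 0 < ‖u‖ := norm_pos_iff.mpr hu
  obtain ⟨s, hs⟩ : ∃ s : ℝ, s ^ 2 = (‖u‖ ^ 2 + r₁ ^ 2 - r₂ ^ 2) ^ 2 - 4 * ‖u‖ ^ 2 * r₁ ^ 2 :=
    ⟨_, Real.sq_sqrt hD.le⟩
  obtain ⟨t, ht⟩ : ∃ t, 2 * ‖u‖ ^ 2 * t = ‖u‖ ^ 2 + r₁ ^ 2 - r₂ ^ 2 + s :=
    ⟨(‖u‖ ^ 2 + r₁ ^ 2 - r₂ ^ 2 + s) / (2 * ‖u‖ ^ 2), by field_simp⟩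
  generalize hdd : ‖u‖ = d at *
  have hq : d ^ 2 * t ^ 2 - (d ^ 2 + r₁ ^ 2 - r₂ ^ 2) * t + r₁ ^ 2 = 0 := by
    have hse : s = 2 * d ^ 2 * t - (d ^ 2 + r₁ ^ 2 - r₂ ^ 2) := by linarith
    rw [hse] at hs
    have : (4 * d ^ 2) * (d ^ 2 * t ^ 2 - (d ^ 2 + r₁ ^ 2 - r₂ ^ 2) * t + r₁ ^ 2) = 0 := by
      linarith
    exact (mul_eq_zero.mp this).resolve_left (by positivity)
  have h₁ : t ^ 2 * d ^ 2 - r₁ ^ 2 ≠ 0 := by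
    intro h
    have ht0 : t ≠ 0 := by
      rintro rfl
      have : 0 < r₁ ^ 2 := by positivity
      linarith
    have h4 : t * (2 * d ^ 2 * t - (d ^ 2 + r₁ ^ 2 - r₂ ^ 2)) = 0 := by linarith
    have h5 := (mul_eq_zero.mp h4).resolve_left ht0
    have h6 : d ^ 2 + r₁ ^ 2 - r₂ ^ 2 = 2 * d ^ 2 * t := by linarith
    have h7 : r₁ ^ 2 = t ^ 2 * d ^ 2 := by linarith
    rw [h6, h7] at hD
    ring_nf at hD
    exact lt_irrefl _ hD
  have hkk : -t * ((1 - t) ^ 2 * d ^ 2 - r₂ ^ 2) = (1 - t) * (t ^ 2 * d ^ 2 - r₁ ^ 2) := by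
    linarith
  have h₂ : (1 - t) ^ 2 * d ^ 2 - r₂ ^ 2 ≠ 0 := by
    intro h
    rw [h, mul_zero] at hkk
    have h8 := (mul_eq_zero.mp hkk.symm).resolve_right h₁
    rw [h8] at h
    have : 0 < r₂ ^ 2 := by positivity
    linarith
  have e₁ : c₁ - (c₁ + t • u) = (-t) • u := by rw [neg_smul]; abel
  have e₂ : c₁ + u - (c₁ + t • u) = (1 - t) • u := by rw [sub_smul, one_smul]; abel
  refine assemble_aux c₁ (c₁ + u) (c₁ + t • u) r₁ r₂ _ _ hr₁ hr₂ ?_ ?_ h₁ h₂ ?_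
  · rw [e₁, norm_smul, hdd, mul_pow, Real.norm_eq_abs, sq_abs, neg_sq]
  · rw [e₂, norm_smul, hdd, mul_pow, Real.norm_eq_abs, sq_abs]
  · rw [e₁, e₂, smul_smul, smul_smul]
    congr 1
    rw [inv_mul_eq_div, inv_mul_eq_div, div_eq_div_iff h₁ h₂]
    exact hkk
end
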